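/- Assume M ≥ N, equi-divisible congestion, and (when M > N) μ_N > μ_{N+1}, so that the grand-coalition partition P_G has a unique NE φ_G (up to relabeling of players), namely the injective profiles with image {a₁,…,a_N}. If the P-NE pair (P_G, φ_G) is not stable at β = 0, then (P_G, φ_G), and hence the grand-coalition partition P_G, is not stable at cost β for any β ≥ 0. -/

import Mathlib

open Finset

namespace CG

variable {N M : ℕ}

/-- Number of players choosing link `a` under profile `φ`. -/
def gamma (φ : Fin N → Fin M) (a : Fin M) : ℕ :=
  (Finset.univ.filter fun i => φ i = a).card

/-- Utility of coalition `C` under profile `φ` at per-communication cost `β`. -/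
noncomputable def util (μ : Fin M → ℕ → ℝ) (β : ℝ) (C : Finset (Fin N))
    (φ : Fin N → Fin M) : ℝ :=
  (∑ i ∈ C, μ (φ i) (gamma φ (φ i))) - ((C.card : ℝ) - 1) * β

/-- `P` is a partition of the player set into (nonempty, pairwise disjoint) coalitions. -/
def IsPartition (P : Finset (Finset (Fin N))) : Prop :=
  (∀ C ∈ P, C.Nonempty) ∧
  (∀ C ∈ P, ∀ C' ∈ P, C ≠ C' → Disjoint C C') ∧
  (∀ i : Fin N, ∃ C ∈ P, i ∈ C)

/-- `φ` is a Nash equilibrium for partition `P`: no coalition of `P` can strictly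
improve its utility by unilaterally changing the strategies of its own members. -/
def IsNE (μ : Fin M → ℕ → ℝ) (β : ℝ) (P : Finset (Finset (Fin N)))
    (φ : Fin N → Fin M) : Prop :=
  ∀ C ∈ P, ∀ φ' : Fin N → Fin M, (∀ i ∉ C, φ' i = φ i) →
    util μ β C φ' ≤ util μ β C φ

/-- Pessimal anticipated worth of a coalition `C`. -/
noncomputable def pess (μ : Fin M → ℕ → ℝ) (β : ℝ) (C : Finset (Fin N)) : ℝ :=
  sInf {x : ℝ | ∃ P' : Finset (Finset (Fin N)), ∃ φ' : Fin N → Fin M,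
    IsPartition P' ∧ C ∈ P' ∧ IsNE μ β P' φ' ∧ x = util μ β C φ'}

/-- `ψ` is a payoff vector consistent with `(P, φ)`. -/
def Consistent (μ : Fin M → ℕ → ℝ) (β : ℝ) (P : Finset (Finset (Fin N)))
    (φ : Fin N → Fin M) (ψ : Fin N → ℝ) : Prop :=
  (∀ j, 0 ≤ ψ j) ∧ ∀ C ∈ P, ∑ j ∈ C, ψ j = util μ β C φ

/-- Coalition `C ∉ P` blocks the configuration with payoff vector `ψ`. -/
def Blocks (μ : Fin M → ℕ → ℝ) (β : ℝ) (P : Finset (Finset (Fin N)))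
    (ψ : Fin N → ℝ) (C : Finset (Fin N)) : Prop :=
  C.Nonempty ∧ C ∉ P ∧ ∑ j ∈ C, ψ j < pess μ β C

/-- The configuration `(P, φ, ψ)` is stable. -/
def ConfigStable (μ : Fin M → ℕ → ℝ) (β : ℝ) (P : Finset (Finset (Fin N)))
    (φ : Fin N → Fin M) (ψ : Fin N → ℝ) : Prop :=
  IsPartition P ∧ IsNE μ β P φ ∧ Consistent μ β P φ ψ ∧
    ∀ C : Finset (Fin N), ¬ Blocks μ β P ψ C

/-- The P-NE pair `(P, φ)` is stable. -/
def PairStable (μ : Fin M → ℕ → ℝ) (β : ℝ) (P : Finset (Finset (Fin N)))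
    (φ : Fin N → Fin M) : Prop :=
  ∃ ψ : Fin N → ℝ, ConfigStable μ β P φ ψ

/-- The partition `P` is stable. -/
def PartStable (μ : Fin M → ℕ → ℝ) (β : ℝ) (P : Finset (Finset (Fin N))) : Prop :=
  ∃ φ : Fin N → Fin M, PairStable μ β P φ

/-- The ALC partition, in which every player is a singleton coalition. -/
def ALC (N : ℕ) : Finset (Finset (Fin N)) :=
  Finset.univ.image fun i => ({i} : Finset (Fin N))

/-- `D_C^P = Σ_i q_i(C)/l_i − 1`. -/
noncomputable def Dcoef (P : Finset (Finset (Fin N))) (C : Finset (Fin N)) : ℝ :=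
  (∑ Ci ∈ P, ((Ci ∩ C).card : ℝ) / (Ci.card : ℝ)) - 1

/-- `Γ_C^P(φ) = Σ_i (q_i(C)/l_i) ν_{C_i}^{0,P}(φ) − ν̲_C^0`. -/
noncomputable def Gam (μ : Fin M → ℕ → ℝ) (P : Finset (Finset (Fin N)))
    (φ : Fin N → Fin M) (C : Finset (Fin N)) : ℝ :=
  (∑ Ci ∈ P, ((Ci ∩ C).card : ℝ) / (Ci.card : ℝ) * util μ 0 Ci φ) - pess μ 0 C

/-- `B^{--}`. -/
def Bmm (μ : Fin M → ℕ → ℝ) (P : Finset (Finset (Fin N))) (φ : Fin N → Fin M) :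
    Set (Finset (Fin N)) :=
  {C | (C.Nonempty ∧ C ∉ P) ∧ Dcoef P C ≤ 0 ∧ Gam μ P φ C < 0}

/-- `B^{+-}`. -/
def Bpm (μ : Fin M → ℕ → ℝ) (P : Finset (Finset (Fin N))) (φ : Fin N → Fin M) :
    Set (Finset (Fin N)) :=
  {C | (C.Nonempty ∧ C ∉ P) ∧ 0 < Dcoef P C ∧ Gam μ P φ C < 0}

/-- `B^{-+}`. -/
def Bmp (μ : Fin M → ℕ → ℝ) (P : Finset (Finset (Fin N))) (φ : Fin N → Fin M) :
    Set (Finset (Fin N)) :=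
  {C | (C.Nonempty ∧ C ∉ P) ∧ Dcoef P C < 0 ∧ 0 ≤ Gam μ P φ C}

/-- `β̄_u^P(φ) = min_{C ∈ B^{-+}} (−Γ_C^P(φ)/D_C^P)`, with `min ∅ = +∞` (in `EReal`). -/
noncomputable def betaU (μ : Fin M → ℕ → ℝ) (P : Finset (Finset (Fin N)))
    (φ : Fin N → Fin M) : EReal :=
  sInf ((fun C => ((-(Gam μ P φ C) / Dcoef P C : ℝ) : EReal)) '' Bmp μ P φ)

/-- `β̄_d^P(φ) = max_{C ∈ B^{+-}} (−Γ_C^P(φ)/D_C^P)`, with `max ∅ = 0` (in `EReal`). -/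
noncomputable def betaD (μ : Fin M → ℕ → ℝ) (P : Finset (Finset (Fin N)))
    (φ : Fin N → Fin M) : EReal :=
  sSup (insert (0 : EReal)
    ((fun C => ((-(Gam μ P φ C) / Dcoef P C : ℝ) : EReal)) '' Bpm μ P φ))

end CG
namespace CG

lemma gamma_pos {N M : ℕ} (φ : Fin N → Fin M) (i : Fin N) : 1 ≤ gamma φ (φ i) :=
  Finset.card_pos.2 ⟨i, by simp⟩

lemma gamma_le {N M : ℕ} (φ : Fin N → Fin M) (a : Fin M) : gamma φ a ≤ N :=
  (Finset.card_le_univ _).trans_eq (Fintype.card_fin N)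

lemma util_eq_sub {N M : ℕ} (μ : Fin M → ℕ → ℝ) (β : ℝ) (C : Finset (Fin N))
    (φ : Fin N → Fin M) : util μ β C φ = util μ 0 C φ - ((C.card : ℝ) - 1) * β := by
  simp [util]

lemma isNE_iff_zero {N M : ℕ} (μ : Fin M → ℕ → ℝ) (β : ℝ) (P : Finset (Finset (Fin N)))
    (φ : Fin N → Fin M) : IsNE μ β P φ ↔ IsNE μ 0 P φ := by
  simp [IsNE, util]

lemma util_zero_nonneg {N M : ℕ} {μ : Fin M → ℕ → ℝ}
    (hpos : ∀ a : Fin M, ∀ k : ℕ, 1 ≤ k → k ≤ N → 0 < μ a k) (C : Finset (Fin N))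
    (φ : Fin N → Fin M) : 0 ≤ util μ 0 C φ := by
  simp only [util, mul_zero, sub_zero]
  exact Finset.sum_nonneg fun i _ => (hpos _ _ (gamma_pos φ i) (gamma_le φ _)).le

/-- The coalition utilities over which the pessimal anticipated worth is the infimum. -/
def worths {N M : ℕ} (μ : Fin M → ℕ → ℝ) (β : ℝ) (C : Finset (Fin N)) : Set ℝ :=
  {x : ℝ | ∃ P' : Finset (Finset (Fin N)), ∃ φ' : Fin N → Fin M,
    IsPartition P' ∧ C ∈ P' ∧ IsNE μ β P' φ' ∧ x = util μ β C φ'}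

lemma gamma_comp_perm {N M : ℕ} (φ : Fin N → Fin M) (σ : Equiv.Perm (Fin N)) (a : Fin M) :
    gamma (φ ∘ σ) a = gamma φ a :=
  Finset.card_bij (fun i _ => σ i) (by simp) (by simp)
    fun j hj => ⟨σ.symm j, by simpa using hj, by simp⟩

lemma util_map_perm {N M : ℕ} (μ : Fin M → ℕ → ℝ) (β : ℝ) (C : Finset (Fin N))
    (φ : Fin N → Fin M) (σ : Equiv.Perm (Fin N)) :
    util μ β (C.map σ.toEmbedding) φ = util μ β C (φ ∘ σ) := by
  simp [util, gamma_comp_perm]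

lemma isPartition_map_perm {N : ℕ} {P : Finset (Finset (Fin N))} (hP : IsPartition P)
    (σ : Equiv.Perm (Fin N)) :
    IsPartition (P.image fun C => C.map σ.toEmbedding) := by
  obtain ⟨hne, hdisj, hcover⟩ := hP
  refine ⟨?_, ?_, fun i => ?_⟩
  · simpa using hne
  · simp only [Finset.mem_image]
    rintro _ ⟨C, hC, rfl⟩ _ ⟨D, hD, rfl⟩ h
    exact (Finset.disjoint_map _).2 (hdisj C hC D hD fun e => h (by rw [e]))
  · obtain ⟨C, hC, hi⟩ := hcover (σ.symm i)
    exact ⟨_, Finset.mem_image_of_mem _ hC, Finset.mem_map.2 ⟨_, hi, by simp⟩⟩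

lemma isNE_map_perm {N M : ℕ} {μ : Fin M → ℕ → ℝ} {β : ℝ} {P : Finset (Finset (Fin N))}
    {φ : Fin N → Fin M} (h : IsNE μ β P φ) (σ : Equiv.Perm (Fin N)) :
    IsNE μ β (P.image fun C => C.map σ.toEmbedding) (φ ∘ σ.symm) := by
  intro D hD φ' hφ'
  obtain ⟨C, hC, rfl⟩ := Finset.mem_image.1 hD
  rw [util_map_perm, util_map_perm]
  have hσ : (φ ∘ σ.symm) ∘ σ = φ := by ext; simp
  rw [hσ]
  refine h C hC _ fun i hi => ?_
  simpa using hφ' (σ i) (by simpa using hi)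

lemma worths_subset_map_perm {N M : ℕ} (μ : Fin M → ℕ → ℝ) (β : ℝ) (C : Finset (Fin N))
    (σ : Equiv.Perm (Fin N)) : worths μ β C ⊆ worths μ β (C.map σ.toEmbedding) := by
  rintro x ⟨P, φ, hP, hC, hφ, rfl⟩
  refine ⟨_, _, isPartition_map_perm hP σ, Finset.mem_image_of_mem _ hC,
    isNE_map_perm hφ σ, ?_⟩
  rw [util_map_perm]
  congr 1
  ext
  simp

lemma pess_map_perm {N M : ℕ} (μ : Fin M → ℕ → ℝ) (β : ℝ) (C : Finset (Fin N))
    (σ : Equiv.Perm (Fin N)) : pess μ β (C.map σ.toEmbedding) = pess μ β C := by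
  have hsub := worths_subset_map_perm μ β (C.map σ.toEmbedding) σ.symm
  have hC : (C.map σ.toEmbedding).map σ.symm.toEmbedding = C := by
    ext i
    simp
  rw [hC] at hsub
  exact congrArg sInf (hsub.antisymm (worths_subset_map_perm μ β C σ))

lemma pess_zero_sub_le {N M : ℕ} {μ : Fin M → ℕ → ℝ}
    (hpos : ∀ a : Fin M, ∀ k : ℕ, 1 ≤ k → k ≤ N → 0 < μ a k) (β : ℝ) {C : Finset (Fin N)}
    (hC : (worths μ 0 C).Nonempty) :
    pess μ 0 C - ((C.card : ℝ) - 1) * β ≤ pess μ β C := by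
  have hbdd : BddBelow (worths μ 0 C) := by
    refine ⟨0, ?_⟩
    rintro _ ⟨_, φ, _, _, _, rfl⟩
    exact util_zero_nonneg hpos C φ
  refine le_csInf ?_ ?_
  · obtain ⟨_, P, φ, hP, hCP, hφ, rfl⟩ := hC
    exact ⟨_, P, φ, hP, hCP, (isNE_iff_zero μ β P φ).2 hφ, rfl⟩
  · rintro _ ⟨P, φ, hP, hCP, hφ, rfl⟩
    have : pess μ 0 C ≤ util μ 0 C φ :=
      csInf_le hbdd ⟨P, φ, hP, hCP, (isNE_iff_zero μ β P φ).1 hφ, rfl⟩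
    rw [util_eq_sub]
    linarith

/-- Under equi-divisible congestion every occupied link contributes its single-user reward. -/
lemma util_univ_zero_eq_sum_image {N M : ℕ} {μ : Fin M → ℕ → ℝ}
    (hequi : ∀ a : Fin M, ∀ k : ℕ, 1 ≤ k → μ a k = μ a 1 / k) (φ : Fin N → Fin M) :
    util μ 0 Finset.univ φ = ∑ a ∈ Finset.univ.image φ, μ a 1 := by
  simp only [util, mul_zero, sub_zero]
  rw [Finset.sum_comp (fun a => μ a (gamma φ a)) φ]
  refine Finset.sum_congr rfl fun a ha => ?_
  obtain ⟨i, -, rfl⟩ := Finset.mem_image.1 ha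
  have h := gamma_pos φ i
  rw [hequi _ _ h, nsmul_eq_mul]
  change (gamma φ (φ i) : ℝ) * _ = _
  have : (gamma φ (φ i) : ℝ) ≠ 0 := by positivity
  field_simp

lemma sum_le_sum_of_threshold {α : Type*} [DecidableEq α] {S T : Finset α} {f : α → ℝ} {c : ℝ}
    (hc : 0 ≤ c) (hcard : S.card ≤ T.card) (hT : ∀ a ∈ T, c ≤ f a) (hS : ∀ a ∉ T, f a ≤ c) :
    ∑ a ∈ S, f a ≤ ∑ a ∈ T, f a := by
  have hle : ∑ a ∈ S \ T, f a ≤ ∑ a ∈ T \ S, f a := calc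
    ∑ a ∈ S \ T, f a ≤ (S \ T).card • c :=
      Finset.sum_le_card_nsmul _ _ _ fun a ha => hS a (Finset.mem_sdiff.1 ha).2
    _ ≤ (T \ S).card • c := by
      have := Finset.card_sdiff_le_card_sdiff_iff.2 hcard
      gcongr
    _ ≤ ∑ a ∈ T \ S, f a :=
      Finset.card_nsmul_le_sum _ _ _ fun a ha => hT a (Finset.mem_sdiff.1 ha).1
  rw [← Finset.sum_inter_add_sum_sdiff S T, ← Finset.sum_inter_add_sum_sdiff T S,
    Finset.inter_comm T S]
  linarith

lemma util_univ_zero_le_of_injective {N M : ℕ} (hN : 0 < N) (hMN : N ≤ M)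
    {μ : Fin M → ℕ → ℝ}
    (hpos : ∀ a : Fin M, ∀ k : ℕ, 1 ≤ k → k ≤ N → 0 < μ a k)
    (hmono : ∀ a b : Fin M, a ≤ b → μ b 1 ≤ μ a 1)
    (hequi : ∀ a : Fin M, ∀ k : ℕ, 1 ≤ k → μ a k = μ a 1 / k)
    {φG : Fin N → Fin M} (hinj : Function.Injective φG) (htop : ∀ i, (φG i : ℕ) < N)
    (φ : Fin N → Fin M) : util μ 0 Finset.univ φ ≤ util μ 0 Finset.univ φG := by
  rw [util_univ_zero_eq_sum_image hequi, util_univ_zero_eq_sum_image hequi]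
  refine sum_le_sum_of_threshold (c := μ ⟨N - 1, by omega⟩ 1) (hpos _ _ le_rfl hN).le ?_ ?_ ?_
  · rw [Finset.card_image_of_injective _ hinj]
    exact Finset.card_image_le
  · intro a ha
    obtain ⟨i, -, rfl⟩ := Finset.mem_image.1 ha
    exact hmono _ _ (Fin.le_def.2 (Nat.le_sub_one_of_lt (htop i)))
  · intro a ha
    refine hmono _ _ (Fin.le_def.2 ?_)
    by_contra! hlt
    have hbij : Function.Bijective fun i => (⟨φG i, htop i⟩ : Fin N) :=
      Finite.injective_iff_bijective.1 fun i j h => hinj (Fin.ext (by simpa using h))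
    obtain ⟨i, hi⟩ := hbij.2 ⟨a, by simp only at hlt; omega⟩
    exact ha (Finset.mem_image.2 ⟨i, Finset.mem_univ _, Fin.ext (by simpa using hi)⟩)

/-- Double counting over the cyclic translates of `C`. -/
lemma sum_sum_map_addRight {N : ℕ} [NeZero N] (ψ : Fin N → ℝ) (C : Finset (Fin N)) :
    ∑ k : Fin N, ∑ j ∈ C.map (Equiv.addRight k).toEmbedding, ψ j = C.card * ∑ j, ψ j := by
  simp only [Finset.sum_map, Equiv.coe_toEmbedding, Equiv.coe_addRight]
  rw [Finset.sum_comm]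
  have (x : Fin N) : ∑ k, ψ (x + k) = ∑ j, ψ j := Equiv.sum_comp (Equiv.addLeft x) ψ
  simp [this]

/-- Stability of the grand coalition at some nonnegative cost forces the equal split to satisfy
every coalition at zero cost. -/
lemma pess_zero_le_of_pairStable {N M : ℕ} (hN : 0 < N) {μ : Fin M → ℕ → ℝ}
    (hpos : ∀ a : Fin M, ∀ k : ℕ, 1 ≤ k → k ≤ N → 0 < μ a k) {β : ℝ} (hβ : 0 ≤ β)
    {φ : Fin N → Fin M} (h : PairStable μ β {Finset.univ} φ) {C : Finset (Fin N)}
    (hC : C.Nonempty) (hCu : C ≠ Finset.univ) :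
    pess μ 0 C ≤ C.card * (util μ 0 Finset.univ φ / N) := by
  have hN' : (0 : ℝ) < N := by exact_mod_cast hN
  have : NeZero N := ⟨hN.ne'⟩
  obtain hemp | hne := (worths μ 0 C).eq_empty_or_nonempty
  · have h0 : pess μ 0 C = 0 := by
      change sInf (worths μ 0 C) = 0
      rw [hemp, Real.sInf_empty]
    rw [h0]
    have := util_zero_nonneg hpos Finset.univ φ
    positivity
  obtain ⟨ψ, -, -, ⟨-, hψ⟩, hblock⟩ := h
  have htot := hψ _ (Finset.mem_singleton_self _)
  rw [util_eq_sub, Finset.card_univ, Fintype.card_fin] at htot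
  have hshift (k : Fin N) : pess μ 0 C - ((C.card : ℝ) - 1) * β ≤
      ∑ j ∈ C.map (Equiv.addRight k).toEmbedding, ψ j := by
    refine (pess_zero_sub_le hpos β hne).trans ?_
    rw [← pess_map_perm μ β C (Equiv.addRight k)]
    by_contra! hlt
    refine hblock _ ⟨hC.map, ?_, hlt⟩
    rw [Finset.mem_singleton, ← Finset.card_eq_iff_eq_univ, Finset.card_map]
    rwa [Ne, ← Finset.card_eq_iff_eq_univ] at hCu
  have hsum := Finset.sum_le_sum fun k (_ : k ∈ Finset.univ) => hshift k
  rw [sum_sum_map_addRight, htot, Finset.sum_const, Finset.card_univ, Fintype.card_fin,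
    nsmul_eq_mul] at hsum
  have hcN : (C.card : ℝ) ≤ N := by
    exact_mod_cast (Finset.card_le_univ C).trans_eq (Fintype.card_fin N)
  rw [← mul_div_assoc, le_div_iff₀ hN']
  nlinarith [mul_nonneg (sub_nonneg.2 hcN) hβ]

lemma isPartition_singleton_univ {N : ℕ} (hN : 0 < N) :
    IsPartition ({Finset.univ} : Finset (Finset (Fin N))) :=
  ⟨by simpa using ⟨(⟨0, hN⟩ : Fin N), Finset.mem_univ _⟩, by simp, by simp⟩

end CG

open CG in
/-- with equi-divisible congestion (and `μ_N > μ_{N+1}` when `M > N`),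
if the unique grand-coalition P-NE pair `(P_G, φ_G)` is not stable at `β = 0`, then
neither the pair nor the grand-coalition partition is stable at any cost `β ≥ 0`. -/
theorem stmt7 {N M : ℕ} (hN : 2 ≤ N) (hMN : N ≤ M)
    (μ : Fin M → ℕ → ℝ)
    (hpos : ∀ a : Fin M, ∀ k : ℕ, 1 ≤ k → k ≤ N → 0 < μ a k)
    (hmono : ∀ a b : Fin M, a ≤ b → μ b 1 ≤ μ a 1)
    (hequi : ∀ a : Fin M, ∀ k : ℕ, 1 ≤ k → μ a k = μ a 1 / k)
    (hgap : ∀ h : N < M, μ (⟨N, h⟩ : Fin M) 1 < μ (Fin.castLE hMN ⟨N - 1, by omega⟩) 1)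
    (φG : Fin N → Fin M) (hinj : Function.Injective φG) (htop : ∀ i, (φG i : ℕ) < N)
    (h0 : ¬ PairStable μ 0 ({Finset.univ} : Finset (Finset (Fin N))) φG) :
    ∀ β : ℝ, 0 ≤ β →
      ¬ PairStable μ β ({Finset.univ} : Finset (Finset (Fin N))) φG ∧
      ¬ PartStable μ β ({Finset.univ} : Finset (Finset (Fin N))) := by
  have hN0 : 0 < N := by omega
  have hN' : (N : ℝ) ≠ 0 := by positivity
  have hmax := util_univ_zero_le_of_injective hN0 hMN hpos hmono hequi hinj htop
  have key : ∀ β : ℝ, 0 ≤ β → ¬ PartStable μ β ({Finset.univ} : Finset (Finset (Fin N))) := by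
    rintro β hβ ⟨φ, hφ⟩
    refine h0 ⟨fun _ => util μ 0 Finset.univ φG / N, isPartition_singleton_univ hN0, ?_,
      ⟨fun _ => ?_, ?_⟩, ?_⟩
    · intro C hC φ' _
      rw [Finset.mem_singleton.1 hC]
      exact hmax φ'
    · have := util_zero_nonneg hpos Finset.univ φG
      positivity
    · intro C hC
      rw [Finset.mem_singleton.1 hC, Finset.sum_const, Finset.card_univ, Fintype.card_fin,
        nsmul_eq_mul]
      field_simp
    · rintro C ⟨hC, hCu, hlt⟩
      have hle := pess_zero_le_of_pairStable hN0 hpos hβ hφ hC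
        (by simpa using hCu)
      rw [Finset.sum_const, nsmul_eq_mul] at hlt
      have : (C.card : ℝ) * (util μ 0 Finset.univ φ / N) ≤
          C.card * (util μ 0 Finset.univ φG / N) := by
        have := hmax φ
        gcongr
      linarith
  exact fun β hβ => ⟨fun h => key β hβ ⟨φG, h⟩, key β hβ⟩
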